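/- Let g, h : ℝⁿ → ℝ be twice continuously differentiable on an open set U ⊆ ℝⁿ and let B ⊆ U. Let L_g and L_h be proper subsets of {1,…,n} with L_g ∪ L_h = {1,…,n}, such that g depends at most linearly on x_i for all i ∈ L_g and h depends at most linearly on x_i for all i ∈ L_h. Suppose every eigenvalue of ∇²_{L_gᶜ} g(x) lies in [λ̲_g, λ̄_g] and every eigenvalue of ∇²_{L_hᶜ} h(x) lies in [λ̲_h, λ̄_h], for every x ∈ B. Then (i) for every x ∈ B every eigenvalue of the full Hessian ∇²(g+h)(x) lies in [min{λ̲_g, λ̲_h, 0}, max{λ̄_g, λ̄_h, 0}], and (ii) this interval is contained in the interval [min{λ̲_g, 0} + min{λ̲_h, 0}, max{λ̄_g, 0} + max{λ̄_h, 0}] obtained by adding the eigenvalue bounds of ∇²g and ∇²h computed without exploiting sparsity. -/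

import Mathlib

open scoped BigOperators

/-- First partial derivative `∂f/∂x_i (x)`. -/
noncomputable def pd {n : ℕ} (f : (Fin n → ℝ) → ℝ) (i : Fin n) (x : Fin n → ℝ) : ℝ :=
  fderiv ℝ f x (Pi.single i 1)

/-- Second partial derivative `∂²f/∂x_i∂x_j (x)` (differentiate w.r.t. `x_j` first, then `x_i`). -/
noncomputable def pd2 {n : ℕ} (f : (Fin n → ℝ) → ℝ) (i j : Fin n) (x : Fin n → ℝ) : ℝ :=
  pd (fun y => pd f j y) i x

/-- Hessian matrix `∇²f(x)` with entries `(∇²f(x))_{ij} = ∂²f/∂x_i∂x_j (x)`. -/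
noncomputable def hess {n : ℕ} (f : (Fin n → ℝ) → ℝ) (x : Fin n → ℝ) :
    Matrix (Fin n) (Fin n) ℝ :=
  Matrix.of fun i j => pd2 f i j x

/-- Reduced Hessian `∇²_J f(x)` indexed by the elements of `J` in ascending order. -/
noncomputable def redHess {n : ℕ} (f : (Fin n → ℝ) → ℝ) (J : Finset (Fin n)) (x : Fin n → ℝ) :
    Matrix (Fin J.card) (Fin J.card) ℝ :=
  Matrix.of fun i j => pd2 f (J.orderIsoOfFin rfl i).1 (J.orderIsoOfFin rfl j).1 x

/-- Every eigenvalue of the (symmetric) matrix `M` lies in `[lo, hi]`. -/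
def eigsIn {m : ℕ} (M : Matrix (Fin m) (Fin m) ℝ) (lo hi : ℝ) : Prop :=
  ∀ (μ : ℝ) (v : Fin m → ℝ), v ≠ 0 → M.mulVec v = μ • v → lo ≤ μ ∧ μ ≤ hi

lemma pd2_eq_fderiv_fderiv {n : ℕ} {f : (Fin n → ℝ) → ℝ} {x : Fin n → ℝ}
    (hf : ContDiffAt ℝ 2 f x) (i j : Fin n) :
    pd2 f i j x = fderiv ℝ (fderiv ℝ f) x (Pi.single i 1) (Pi.single j 1) := by
  have hd : DifferentiableAt ℝ (fderiv ℝ f) x :=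
    (hf.fderiv_right (m := 1) (by norm_num)).differentiableAt (by norm_num)
  unfold pd2 pd
  rw [fderiv_clm_apply hd (differentiableAt_const _)]
  simp

lemma pd2_comm {n : ℕ} {f : (Fin n → ℝ) → ℝ} {x : Fin n → ℝ}
    (hf : ContDiffAt ℝ 2 f x) (i j : Fin n) : pd2 f i j x = pd2 f j i x := by
  rw [pd2_eq_fderiv_fderiv hf, pd2_eq_fderiv_fderiv hf]
  exact hf.isSymmSndFDerivAt (by simp) _ _

lemma pd2_add {n : ℕ} {g h : (Fin n → ℝ) → ℝ} {x : Fin n → ℝ}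
    (hg : ContDiffAt ℝ 2 g x) (hh : ContDiffAt ℝ 2 h x) (i j : Fin n) :
    pd2 (fun y => g y + h y) i j x = pd2 g i j x + pd2 h i j x := by
  have hdg : DifferentiableAt ℝ (fderiv ℝ g) x :=
    (hg.fderiv_right (m := 1) (by norm_num)).differentiableAt (by norm_num)
  have hdh : DifferentiableAt ℝ (fderiv ℝ h) x :=
    (hh.fderiv_right (m := 1) (by norm_num)).differentiableAt (by norm_num)
  have hev : fderiv ℝ (fun y => g y + h y) =ᶠ[nhds x] fun y => fderiv ℝ g y + fderiv ℝ h y := by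
    filter_upwards [hg.eventually (by simp), hh.eventually (by simp)] with y hgy hhy
    exact fderiv_fun_add (hgy.differentiableAt (by norm_num))
      (hhy.differentiableAt (by norm_num))
  rw [pd2_eq_fderiv_fderiv (hg.add hh), pd2_eq_fderiv_fderiv hg, pd2_eq_fderiv_fderiv hh,
    hev.fderiv_eq, fderiv_fun_add hdg hdh]
  simp

lemma pd2_eq_zero_of_pd_const {n : ℕ} {f : (Fin n → ℝ) → ℝ} {U : Set (Fin n → ℝ)}
    (hU : IsOpen U) {x : Fin n → ℝ} (hx : x ∈ U) {j : Fin n}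
    (hc : ∃ c : ℝ, ∀ y ∈ U, pd f j y = c) (i : Fin n) : pd2 f i j x = 0 := by
  obtain ⟨c, hc⟩ := hc
  have hev : (fun y => pd f j y) =ᶠ[nhds x] fun _ => c := by
    filter_upwards [hU.mem_nhds hx] with y hy using hc y hy
  unfold pd2
  rw [pd, hev.fderiv_eq]
  simp

/-- An eigenvector that does not vanish on `J` restricts to an eigenvector of the reduced Hessian,
provided the rows of `M` in `J` agree with those of the Hessian and are supported in `J`. -/
lemma eigenvalue_mem_of_redHess {n : ℕ} {f : (Fin n → ℝ) → ℝ} {J : Finset (Fin n)}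
    {x : Fin n → ℝ} {lo hi : ℝ} (hJ : eigsIn (redHess f J x) lo hi)
    {M : Matrix (Fin n) (Fin n) ℝ} (hM : ∀ i ∈ J, ∀ j, M i j = pd2 f i j x)
    (hsupp : ∀ i ∈ J, ∀ j ∉ J, pd2 f i j x = 0) {μ : ℝ} {v : Fin n → ℝ}
    (hv : M.mulVec v = μ • v) {k : Fin n} (hk : k ∈ J) (hvk : v k ≠ 0) : lo ≤ μ ∧ μ ≤ hi := by
  refine hJ μ (fun a => v (J.orderIsoOfFin rfl a).1) (fun h0 => hvk ?_) ?_
  · simpa using congrFun h0 ((J.orderIsoOfFin rfl).symm ⟨k, hk⟩)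
  · ext a
    have hi := (J.orderIsoOfFin rfl a).2
    have ha := congrFun hv (J.orderIsoOfFin rfl a).1
    simp only [Matrix.mulVec, dotProduct, hM _ hi, Pi.smul_apply] at ha
    rw [Pi.smul_apply, ← ha, ← Finset.sum_subset J.subset_univ
      (fun j _ hj => by rw [hsupp _ hi j hj, zero_mul]), ← Finset.sum_coe_sort]
    exact (J.orderIsoOfFin rfl).toEquiv.sum_comp
      (fun j : J => pd2 f (J.orderIsoOfFin rfl a).1 j.1 x * v j.1)

theorem stmt9 {n : ℕ} (hn : 0 < n) (U B : Set (Fin n → ℝ)) (hU : IsOpen U) (hBU : B ⊆ U)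
    (g h : (Fin n → ℝ) → ℝ) (hg : ContDiffOn ℝ 2 g U) (hh : ContDiffOn ℝ 2 h U)
    (Lg Lh : Finset (Fin n)) (hLgp : Lg ≠ Finset.univ) (hLhp : Lh ≠ Finset.univ)
    (hcup : Lg ∪ Lh = Finset.univ)
    (hling : ∀ i ∈ Lg, ∃ c : ℝ, ∀ x ∈ U, pd g i x = c)
    (hlinh : ∀ i ∈ Lh, ∃ c : ℝ, ∀ x ∈ U, pd h i x = c)
    (glo ghi hlo hhi : ℝ) (hgI : glo ≤ ghi) (hhI : hlo ≤ hhi)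
    (hgB : ∀ x ∈ B, eigsIn (redHess g Lgᶜ x) glo ghi)
    (hhB : ∀ x ∈ B, eigsIn (redHess h Lhᶜ x) hlo hhi) :
    (∀ x ∈ B, eigsIn (hess (fun y => g y + h y) x)
      (min glo (min hlo 0)) (max ghi (max hhi 0))) ∧
    Set.Icc (min glo (min hlo 0)) (max ghi (max hhi 0)) ⊆
      Set.Icc (min glo 0 + min hlo 0) (max ghi 0 + max hhi 0) := by
  refine ⟨fun x hx μ v hv0 hv => ?_, ?_⟩
  · have hxU := hBU hx
    have hgx : ContDiffAt ℝ 2 g x := hg.contDiffAt (hU.mem_nhds hxU)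
    have hhx : ContDiffAt ℝ 2 h x := hh.contDiffAt (hU.mem_nhds hxU)
    have hgcol : ∀ j ∈ Lg, ∀ i, pd2 g i j x = 0 := fun j hj =>
      pd2_eq_zero_of_pd_const hU hxU (hling j hj)
    have hhcol : ∀ j ∈ Lh, ∀ i, pd2 h i j x = 0 := fun j hj =>
      pd2_eq_zero_of_pd_const hU hxU (hlinh j hj)
    have hgrow : ∀ i ∈ Lg, ∀ j, pd2 g i j x = 0 := fun i hi j => by
      rw [pd2_comm hgx, hgcol i hi]
    have hhrow : ∀ i ∈ Lh, ∀ j, pd2 h i j x = 0 := fun i hi j => by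
      rw [pd2_comm hhx, hhcol i hi]
    have hsum : ∀ i j, hess (fun y => g y + h y) x i j = pd2 g i j x + pd2 h i j x :=
      pd2_add hgx hhx
    have hmem : ∀ i, i ∈ Lg ∨ i ∈ Lh := fun i => by
      rw [← Finset.mem_union, hcup]
      exact Finset.mem_univ i
    obtain ⟨k, hk⟩ := Function.ne_iff.mp hv0
    rw [Pi.zero_apply] at hk
    by_cases hkg : k ∈ Lg
    · by_cases hkh : k ∈ Lh
      · have hrow := congrFun hv k
        simp only [Matrix.mulVec, dotProduct, hsum, hgrow k hkg, hhrow k hkh, add_zero, zero_mul,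
          Finset.sum_const_zero, Pi.smul_apply, smul_eq_mul] at hrow
        have hμ : μ = 0 := (mul_eq_zero.mp hrow.symm).resolve_right hk
        simp [hμ]
      · have hμ := eigenvalue_mem_of_redHess (hhB x hx)
          (fun i hi j => by
            rw [hsum, hgrow i ((hmem i).resolve_right (Finset.mem_compl.mp hi)), zero_add])
          (fun i _ j hj => hhcol j (by simpa using hj) i) hv (Finset.mem_compl.mpr hkh) hk
        simp [hμ.1, hμ.2]
    · have hμ := eigenvalue_mem_of_redHess (hgB x hx)
        (fun i hi j => by
          rw [hsum, hhrow i ((hmem i).resolve_left (Finset.mem_compl.mp hi)), add_zero])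
        (fun i _ j hj => hgcol j (by simpa using hj) i) hv (Finset.mem_compl.mpr hkg) hk
      simp [hμ.1, hμ.2]
  · apply Set.Icc_subset_Icc
    · have := min_le_right glo 0
      have := min_le_right hlo 0
      refine le_min ?_ (le_min ?_ ?_) <;> linarith [min_le_left glo 0, min_le_left hlo 0]
    · have := le_max_right ghi 0
      have := le_max_right hhi 0
      refine max_le ?_ (max_le ?_ ?_) <;> linarith [le_max_left ghi 0, le_max_left hhi 0]
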